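/- arXiv:2006.15765 — 2 statements merged into one kernel-verified Lean document; each statement's English description precedes it below -/
import Mathlib

section
/- For all X, Y ∈ 𝔭 one has ∑_{j=1}^m A_j(X,Y) = (1/2)·Q(X,Y); that is, the sum of the bilinear forms A_1,…,A_m equals one half of Q restricted to 𝔭. -/
/-- If `g` is minus the adjoint of `f` with respect to a nondegenerate bilinear form, then
`trace f = -trace g`. -/
theorem LinearMap.BilinForm.trace_eq_neg_of_skewAdjoint {K V : Type*} [Field K] [AddCommGroup V]
    [Module K V] [FiniteDimensional K V] {B : LinearMap.BilinForm K V} (hB : B.Nondegenerate)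
    {f g : V →ₗ[K] V} (h : ∀ x y, B (f x) y = -B x (g y)) :
    LinearMap.trace K V f = -LinearMap.trace K V g := by
  have hconj : (B.toDual hB).conj f = Module.Dual.transpose (R := K) (-g) := by
    ext φ y
    obtain ⟨x, rfl⟩ := (B.toDual hB).surjective φ
    simp [LinearEquiv.conj_apply, LinearMap.BilinForm.toDual_def, h,
      Module.Dual.transpose_apply]
  rw [← LinearMap.trace_conj' f (B.toDual hB), hconj, LinearMap.trace_transpose', map_neg]


/-- Lemma 3.5, second identity: `∑ⱼ Aⱼ = (1/2) Q|𝔭`, where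
`A_j(X,Y) = tr(π_{𝔨_j} ∘ ad X ∘ ad Y)` and `π_{𝔨_j}` is the `Q`-orthogonal projection
onto the ideal `𝔨_j`. -/
theorem stmt_1
    (𝔤 : Type*) [LieRing 𝔤] [LieAlgebra ℝ 𝔤] [FiniteDimensional ℝ 𝔤]
    (𝔭 : Submodule ℝ 𝔤) (𝔨 : LieSubalgebra ℝ 𝔤)
    (hcompl : IsCompl 𝔭 𝔨.toSubmodule)
    (hkp : ∀ x ∈ 𝔨, ∀ y ∈ 𝔭, ⁅x, y⁆ ∈ 𝔭)
    (hpp : ∀ x ∈ 𝔭, ∀ y ∈ 𝔭, ⁅x, y⁆ ∈ 𝔨)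
    (horth : ∀ x ∈ 𝔭, ∀ y ∈ 𝔨, killingForm ℝ 𝔤 x y = 0)
    (hpos : ∀ x ∈ 𝔭, x ≠ 0 → 0 < killingForm ℝ 𝔤 x x)
    (hneg : ∀ x ∈ 𝔨, x ≠ 0 → killingForm ℝ 𝔤 x x < 0)
    (Q : LinearMap.BilinForm ℝ 𝔤)
    (hQpp : ∀ x ∈ 𝔭, ∀ y ∈ 𝔭, Q x y = killingForm ℝ 𝔤 x y)
    (hQkk : ∀ x ∈ 𝔨, ∀ y ∈ 𝔨, Q x y = -(killingForm ℝ 𝔤 x y))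
    (hQpk : ∀ x ∈ 𝔭, ∀ y ∈ 𝔨, Q x y = 0 ∧ Q y x = 0)
    (m : ℕ) (𝔨s : Fin m → LieIdeal ℝ ↥𝔨) (κ : Fin m → ℝ)
    (hsup : (⨆ j, 𝔨s j) = ⊤)
    (horthk : ∀ j k, j ≠ k → ∀ x ∈ 𝔨s j, ∀ y ∈ 𝔨s k,
        killingForm ℝ 𝔤 (x : 𝔤) (y : 𝔤) = 0)
    (hκ : ∀ j, ∀ x y : ↥(𝔨s j),
        killingForm ℝ ↥(𝔨s j) x y
          = κ j * killingForm ℝ 𝔤 ((x : ↥𝔨) : 𝔤) ((y : ↥𝔨) : 𝔤))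
    (π : Fin m → (𝔤 →ₗ[ℝ] 𝔤))
    (hπmem : ∀ j x, ∃ y : ↥𝔨, y ∈ 𝔨s j ∧ (y : 𝔤) = π j x)
    (hπorth : ∀ j x, ∀ y : ↥𝔨, y ∈ 𝔨s j → Q (x - π j x) (y : 𝔤) = 0)
    (X : 𝔤) (hX : X ∈ 𝔭) (Y : 𝔤) (hY : Y ∈ 𝔭) :
    ∑ j, LinearMap.trace ℝ 𝔤
        (π j ∘ₗ LieAlgebra.ad ℝ 𝔤 X ∘ₗ LieAlgebra.ad ℝ 𝔤 Y)
      = (1/2) * Q X Y := by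
  have hkdef : ∀ x ∈ 𝔨, killingForm ℝ 𝔤 x x = 0 → x = 0 := fun x hx h ↦ by
    by_contra hne
    exact (hneg x hx hne).ne h
  have hπ_unique : ∀ j x, ∀ z ∈ 𝔨s j,
      (∀ y ∈ 𝔨s j, Q (x - (z : 𝔤)) (y : 𝔤) = 0) → π j x = z := by
    intro j x z hz h
    obtain ⟨y, hy, hyx⟩ := hπmem j x
    have h1 := hπorth j x (y - z) (sub_mem hy hz)
    have h2 := h (y - z) (sub_mem hy hz)
    rw [← hyx] at h1
    have h3 : Q ((y - z : 𝔨) : 𝔤) ((y - z : 𝔨) : 𝔤) = 0 := by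
      have : ((y - z : 𝔨) : 𝔤) = (x - z) - (x - y) := by push_cast; abel
      conv_lhs => enter [1]; rw [this]
      rw [map_sub, LinearMap.sub_apply, h1, h2, sub_zero]
    rw [hQkk _ (y - z).2 _ (y - z).2, neg_eq_zero] at h3
    have h4 := hkdef _ (y - z).2 h3
    rw [← hyx]
    exact sub_eq_zero.mp (by simpa using h4)
  obtain ⟨P, hP⟩ : ∃ P : 𝔤 →ₗ[ℝ] 𝔤, P = ∑ j, π j := ⟨_, rfl⟩
  have hPp : ∀ x ∈ 𝔭, P x = 0 := by
    intro x hx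
    rw [hP, LinearMap.sum_apply]
    refine Finset.sum_eq_zero fun j _ ↦ ?_
    simpa using hπ_unique j x 0 (zero_mem _) fun y _ ↦ by simpa using (hQpk x hx y y.2).1
  have hPk : ∀ x ∈ 𝔨, P x = x := by
    intro x hx
    have hmem : (⟨x, hx⟩ : 𝔨) ∈ ⨆ j, (𝔨s j).toSubmodule := by
      rw [← LieSubmodule.iSup_toSubmodule, hsup]
      trivial
    suffices ∀ z : 𝔨, z ∈ ⨆ j, (𝔨s j).toSubmodule → P z = z from this ⟨x, hx⟩ hmem
    intro z hz
    refine Submodule.iSup_induction _ (motive := fun z : 𝔨 ↦ P z = z) hz ?_ (by simp) ?_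
    · intro j z hz
      rw [hP, LinearMap.sum_apply, Finset.sum_eq_single j]
      · exact hπ_unique j z z hz fun y _ ↦ by simp
      · intro k _ hkj
        simpa using hπ_unique k z 0 (zero_mem _) fun y hy ↦ by
          simpa [hQkk _ z.2 _ y.2] using horthk j k hkj.symm z hz y hy
      · simp
    · intro a b ha hb
      simp [ha, hb]
  have hdecomp : ∀ x, ∃ a ∈ 𝔭, ∃ b ∈ 𝔨, a + b = x := fun x ↦ by
    obtain ⟨a, ha, b, hb, h⟩ :=
      Submodule.mem_sup.mp (hcompl.sup_eq_top ▸ Submodule.mem_top (x := x))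
    exact ⟨a, ha, b, hb, h⟩
  have hsymm : ∀ x y, killingForm ℝ 𝔤 x y = killingForm ℝ 𝔤 y x :=
    LieModule.traceForm_comm ℝ 𝔤 𝔤
  have hPself : ∀ x y, killingForm ℝ 𝔤 (P x) y = killingForm ℝ 𝔤 x (P y) := by
    intro x y
    obtain ⟨a, ha, b, hb, rfl⟩ := hdecomp x
    obtain ⟨c, hc, d, hd, rfl⟩ := hdecomp y
    simp only [map_add, hPp a ha, hPk b hb, hPp c hc, hPk d hd, LinearMap.add_apply, zero_add,
      horth a ha d hd, hsymm b c, horth c hc b hb]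
  have hB : (killingForm ℝ 𝔤).Nondegenerate := by
    have hleft : ∀ x, (∀ y, killingForm ℝ 𝔤 x y = 0) → x = 0 := by
      intro x h
      obtain ⟨a, ha, b, hb, rfl⟩ := hdecomp x
      have h1 := h a
      have h2 := h b
      simp only [map_add, LinearMap.add_apply, horth a ha b hb, hsymm b a, add_zero,
        zero_add] at h1 h2
      have ha0 : a = 0 := by
        by_contra hne
        exact (hpos a ha hne).ne' h1
      rw [ha0, hkdef b hb h2, add_zero]
    exact ⟨hleft, fun y h ↦ hleft y fun x ↦ (hsymm y x).trans (h x)⟩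
  have hswap : ∀ Z ∈ 𝔭, P ∘ₗ LieAlgebra.ad ℝ 𝔤 Z
      = LieAlgebra.ad ℝ 𝔤 Z - LieAlgebra.ad ℝ 𝔤 Z ∘ₗ P := by
    intro Z hZ
    ext x
    obtain ⟨a, ha, b, hb, rfl⟩ := hdecomp x
    have hZb : ⁅Z, b⁆ ∈ 𝔭 := by
      rw [← lie_skew]
      exact neg_mem (hkp b hb Z hZ)
    simp [hPp a ha, hPk b hb, hPk _ (hpp Z hZ a ha), hPp _ hZb]
  have hskew : LinearMap.trace ℝ 𝔤 (P ∘ₗ LieAlgebra.ad ℝ 𝔤 ⁅X, Y⁆) = 0 := by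
    have h := LinearMap.BilinForm.trace_eq_neg_of_skewAdjoint hB
      (f := P ∘ₗ LieAlgebra.ad ℝ 𝔤 ⁅X, Y⁆) (g := LieAlgebra.ad ℝ 𝔤 ⁅X, Y⁆ ∘ₗ P) fun x y ↦ by
        rw [LinearMap.comp_apply, hPself, LieAlgebra.ad_apply, LinearMap.comp_apply,
          LieAlgebra.ad_apply, ← lie_skew, map_neg, LinearMap.neg_apply, neg_inj]
        exact LieModule.traceForm_apply_lie_apply ℝ 𝔤 𝔤 x ⁅X, Y⁆ (P y)
    rw [LinearMap.trace_comp_comm' P (LieAlgebra.ad ℝ 𝔤 ⁅X, Y⁆)] at h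
    linarith
  have hbracket : LinearMap.trace ℝ 𝔤 (P ∘ₗ LieAlgebra.ad ℝ 𝔤 X ∘ₗ LieAlgebra.ad ℝ 𝔤 Y)
      = LinearMap.trace ℝ 𝔤 (P ∘ₗ LieAlgebra.ad ℝ 𝔤 Y ∘ₗ LieAlgebra.ad ℝ 𝔤 X) := by
    rw [← sub_eq_zero, ← map_sub, ← LinearMap.comp_sub, ← hskew]
    congr 2
    ext x
    simp
  have hcycle : LinearMap.trace ℝ 𝔤 (P ∘ₗ LieAlgebra.ad ℝ 𝔤 X ∘ₗ LieAlgebra.ad ℝ 𝔤 Y)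
      = killingForm ℝ 𝔤 X Y
        - LinearMap.trace ℝ 𝔤 (P ∘ₗ LieAlgebra.ad ℝ 𝔤 Y ∘ₗ LieAlgebra.ad ℝ 𝔤 X) := by
    rw [← LinearMap.comp_assoc, hswap X hX, LinearMap.sub_comp, map_sub, LinearMap.comp_assoc,
      LinearMap.trace_comp_comm' (P ∘ₗ LieAlgebra.ad ℝ 𝔤 Y) (LieAlgebra.ad ℝ 𝔤 X),
      LinearMap.comp_assoc]
    rfl
  have hsum : ∑ j, LinearMap.trace ℝ 𝔤 (π j ∘ₗ LieAlgebra.ad ℝ 𝔤 X ∘ₗ LieAlgebra.ad ℝ 𝔤 Y)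
      = LinearMap.trace ℝ 𝔤 (P ∘ₗ LieAlgebra.ad ℝ 𝔤 X ∘ₗ LieAlgebra.ad ℝ 𝔤 Y) := by
    rw [← map_sum, hP]
    congr 1
    ext x
    simp [LinearMap.sum_apply]
  rw [hsum, hQpp X hX Y hY]
  linarith
end

section
/- Assume condition (Z): ∑_{i=1}^m (n²κ_iT_p² − d_i²(1−κ_i)T_i²)/(nT_pT_i) − 2n < 0, let m₀ be an index at which κ_i/T_i attains its maximum over i = 1,…,m, and assume condition (I): (κ_{m₀}/T_{m₀})·(−nT_p + ∑_{i=1}^m d_iT_i) < ∑_{i=1}^m d_i + d_{m₀}(1−κ_{m₀}) − 3n. Then S restricted to M¹ attains its global maximum: there exists (β*,α*) ∈ M¹ with S(β,α) ≤ S(β*,α*) for all (β,α) ∈ M¹. -/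
open Filter Topology in
/-- In inverse coordinates `x = 1/β`, `y i = 1/α i`, the curvature functional takes a value above
its boundary supremum `k / 4`, where `k = κ m₀ / T m₀`. -/
theorem exists_inv_curvature_gt {ι : Type*} [Fintype ι] [DecidableEq ι] (d κ T : ι → ℝ)
    (hd : ∀ i, 0 < d i) (hT : ∀ i, 0 < T i) (n Tp : ℝ)
    (hn : n = 2 * ∑ i, d i * (1 - κ i)) (m₀ : ι)
    (hI : (κ m₀ / T m₀) * (-(n * Tp) + ∑ i, d i * T i)
        < (∑ i, d i) + d m₀ * (1 - κ m₀) - 3 * n) :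
    ∃ (x : ℝ) (y : ι → ℝ), 0 < x ∧ (∀ i, 0 < y i) ∧ -n * Tp * x + ∑ i, d i * T i * y i = 1 ∧
      κ m₀ / T m₀ / 4 < -(1/4) * (∑ i, d i * (1 - κ i) / y i) * x^2 - n * x / 2
        + (1/4) * ∑ i, d i * κ i * y i := by
  have hd₀ := hd m₀
  have hT₀ := hT m₀
  set L := (∑ i, d i) + d m₀ * (1 - κ m₀) - 3 * n
    - (κ m₀ / T m₀) * (-(n * Tp) + ∑ i, d i * T i) with hL
  have hLpos : 0 < L := by linarith
  set w : ℝ → ℝ := fun x ↦ x + (1 + x * (n * Tp - ∑ i, d i * T i)) / (d m₀ * T m₀) with hw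
  have hw0 : 0 < w 0 := by simp only [hw]; ring_nf; positivity
  have hwc : Continuous w := by fun_prop
  have hlim : ContinuousAt (fun x ↦ L - x * (d m₀ * (1 - κ m₀)) / w x) 0 := by
    have := hw0.ne'
    fun_prop (disch := assumption)
  have hev : ∀ᶠ x in 𝓝[>] (0 : ℝ), 0 < w x ∧ 0 < L - x * (d m₀ * (1 - κ m₀)) / w x :=
    nhdsWithin_le_nhds ((hwc.continuousAt.eventually_const_lt hw0).and
      (hlim.eventually_const_lt (by simpa using hLpos)))
  obtain ⟨x, ⟨hwx, hpos⟩, hx⟩ := (hev.and self_mem_nhdsWithin).exists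
  have hx : 0 < x := hx
  have hsum (g : ι → ℝ → ℝ) : ∑ i, g i (Function.update (fun _ ↦ x) m₀ (w x) i)
      = ∑ i, g i x - g m₀ x + g m₀ (w x) := by
    rw [← Finset.add_sum_erase _ _ (Finset.mem_univ m₀),
      ← Finset.add_sum_erase _ (fun i ↦ g i x) (Finset.mem_univ m₀), Function.update_self,
      Finset.sum_congr rfl fun i hi ↦ by rw [Function.update_of_ne (Finset.ne_of_mem_erase hi)]]
    ring
  have hdκ : ∑ i, d i * κ i = ∑ i, d i - n / 2 := by
    rw [hn, mul_div_cancel_left₀ _ two_ne_zero, ← Finset.sum_sub_distrib]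
    exact Finset.sum_congr rfl fun i _ ↦ by ring
  have hwsub : d m₀ * T m₀ * (w x - x) = 1 + x * (n * Tp - ∑ i, d i * T i) := by
    simp only [hw]; field_simp; ring
  refine ⟨x, Function.update (fun _ ↦ x) m₀ (w x), hx, fun i ↦ ?_, ?_, ?_⟩
  · by_cases hi : i = m₀
    · subst hi; simpa using hwx
    · simpa [hi] using hx
  · rw [hsum fun i t ↦ d i * T i * t, ← Finset.sum_mul]
    linarith
  · rw [hsum fun i t ↦ d i * (1 - κ i) / t, hsum fun i t ↦ d i * κ i * t, ← Finset.sum_mul,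
      ← Finset.sum_div, hdκ]
    have hκw : d m₀ * κ m₀ * (w x - x) = κ m₀ / T m₀ * (1 + x * (n * Tp - ∑ i, d i * T i)) := by
      rw [← hwsub]; field_simp
    have hn' : ∑ i, d i * (1 - κ i) = n / 2 := by linarith
    have hsq : ((n / 2) / x - d m₀ * (1 - κ m₀) / x + d m₀ * (1 - κ m₀) / w x) * x ^ 2
        = x * (n / 2 - d m₀ * (1 - κ m₀) + x * (d m₀ * (1 - κ m₀)) / w x) := by
      field_simp
    rw [hn']
    have := mul_pos hx hpos
    simp only [hL] at this
    linarith

/-- A curvature functional in inverse coordinates which exceeds its boundary supremum somewhere,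
and decreases at infinity by condition (Z), attains its maximum. -/
theorem exists_inv_curvature_max {ι : Type*} [Fintype ι] (d κ T : ι → ℝ)
    (hd : ∀ i, 0 < d i) (hκ0 : ∀ i, 0 ≤ κ i) (hκ1 : ∀ i, κ i < 1) (hT : ∀ i, 0 < T i)
    (n Tp k : ℝ) (hn : 0 < n) (hTp : 0 < Tp) (hk0 : 0 ≤ k) (hk : ∀ i, κ i / T i ≤ k)
    (hZ : ∑ i, (n^2 * κ i * Tp^2 - d i^2 * (1 - κ i) * T i^2) / (n * Tp * T i) - 2 * n < 0)
    (G H : ℝ → (ι → ℝ) → ℝ)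
    (hG : ∀ x y, G x y = -(1/4) * (∑ i, d i * (1 - κ i) / y i) * x^2 - n * x / 2
        + (1/4) * ∑ i, d i * κ i * y i)
    (hH : ∀ x y, H x y = -n * Tp * x + ∑ i, d i * T i * y i)
    (x₁ : ℝ) (y₁ : ι → ℝ) (hx₁ : 0 < x₁) (hy₁ : ∀ i, 0 < y₁ i) (h₁ : H x₁ y₁ = 1)
    (hgt : k / 4 < G x₁ y₁) :
    ∃ x y, (0 < x ∧ (∀ i, 0 < y i) ∧ H x y = 1) ∧
      ∀ x' y', 0 < x' → (∀ i, 0 < y' i) → H x' y' = 1 → G x' y' ≤ G x y := by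
  set c := G x₁ y₁
  set Z := ∑ i, (n^2 * κ i * Tp^2 - d i^2 * (1 - κ i) * T i^2) / (n * Tp * T i) - 2 * n with hZdef
  set C := ∑ i, (κ i / T i + d i^2 * (1 - κ i) * T i / (n * Tp)^2) with hC
  set ε := (4 * c - k) / (k * n * Tp + 1) with hε
  set X := C / (-Z) with hX
  have hεpos : 0 < ε := div_pos (by linarith) (by positivity)
  have hκ' (i) : 0 < 1 - κ i := by linarith [hκ1 i]
  have hCnonneg : 0 ≤ C := Finset.sum_nonneg fun i _ ↦ by
    have := hκ0 i; have := hT i; have := hκ' i; positivity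
  have hXnonneg : 0 ≤ X := div_nonneg hCnonneg (by linarith)
  set δ : ι → ℝ := fun i ↦ d i * (1 - κ i) * ε^2 / (k * (1 + n * Tp * X) + 1) with hδ
  have hδpos (i) : 0 < δ i := by
    have := hd i; have := hκ' i; simp only [hδ]; positivity
  set Y : ι → ℝ := fun i ↦ (1 + n * Tp * X) / (d i * T i) with hY
  have hbound (x : ℝ) (y : ι → ℝ) (hx : 0 < x) (hy : ∀ i, 0 < y i) (h : H x y = 1)
      (hc : c ≤ G x y) : x ∈ Set.Icc ε X ∧ y ∈ Set.Icc δ Y := by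
    rw [hH] at h
    rw [hG] at hc
    have hsumT : ∑ i, d i * T i * y i = 1 + n * Tp * x := by linarith
    have hyle (i) : d i * T i * y i ≤ 1 + n * Tp * x := by
      rw [← hsumT]
      exact Finset.single_le_sum (f := fun i ↦ d i * T i * y i)
        (fun j _ ↦ by have := hd j; have := hT j; have := hy j; positivity) (Finset.mem_univ i)
    have hsumκ : ∑ i, d i * κ i * y i ≤ k * (1 + n * Tp * x) := by
      rw [← hsumT, Finset.mul_sum]
      refine Finset.sum_le_sum fun i _ ↦ ?_
      have h1 := (div_le_iff₀ (hT i)).1 (hk i)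
      have h2 := mul_le_mul_of_nonneg_left h1 (mul_pos (hd i) (hy i)).le
      linarith
    have hterm (i) : 0 ≤ d i * (1 - κ i) / y i := by
      have := hd i; have := hκ' i; have := hy i; positivity
    have hsum0 : 0 ≤ (∑ i, d i * (1 - κ i) / y i) * x^2 :=
      mul_nonneg (Finset.sum_nonneg fun i _ ↦ hterm i) (sq_nonneg x)
    have hnx : 0 < n * x := by positivity
    have hεx : ε ≤ x := by
      rw [hε, div_le_iff₀ (by positivity)]
      linarith
    have hxX : x ≤ X := by
      rw [hX, le_div_iff₀ (by linarith)]
      have key : ∑ i, d i * κ i * y i - (∑ i, d i * (1 - κ i) / y i) * x^2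
          ≤ (Z + 2 * n) * x + C := by
        rw [hZdef, sub_add_cancel, hC, Finset.sum_mul, Finset.sum_mul, ← Finset.sum_sub_distrib,
          ← Finset.sum_add_distrib]
        refine Finset.sum_le_sum fun i _ ↦ ?_
        have hdi := hd i
        have hTi := hT i
        have hyi := hy i
        have hκi := hκ' i
        set r := n * Tp with hr
        have hrpos : 0 < r := by positivity
        have hA : d i * κ i * y i ≤ κ i / T i * (1 + r * x) := by
          have := mul_le_mul_of_nonneg_left (hyle i) (div_nonneg (hκ0 i) hTi.le)
          refine le_trans (le_of_eq ?_) this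
          field_simp
        have hB : d i ^ 2 * (1 - κ i) * T i * (x / r - 1 / r ^ 2)
            ≤ d i * (1 - κ i) / y i * x ^ 2 := by
          have h1 : (x / r - 1 / r ^ 2) * (1 + r * x) ≤ x ^ 2 := by
            have : (x / r - 1 / r ^ 2) * (1 + r * x) = x ^ 2 - 1 / r ^ 2 := by
              field_simp; ring
            rw [this]
            linarith [show 0 < 1 / r ^ 2 by positivity]
          have h2 : (x / r - 1 / r ^ 2) * (d i * T i * y i) ≤ x ^ 2 := by
            rcases le_total 0 (x / r - 1 / r ^ 2) with h0 | h0
            · exact (mul_le_mul_of_nonneg_left (hyle i) h0).trans h1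
            · exact (mul_nonpos_of_nonpos_of_nonneg h0 (by positivity)).trans (sq_nonneg x)
          have h3 := mul_le_mul_of_nonneg_left h2 (hterm i)
          refine le_trans (le_of_eq ?_) h3
          field_simp
        have hE : (n ^ 2 * κ i * Tp ^ 2 - d i ^ 2 * (1 - κ i) * T i ^ 2) / (r * T i) * x
            + (κ i / T i + d i ^ 2 * (1 - κ i) * T i / r ^ 2)
            = κ i / T i * (1 + r * x) - d i ^ 2 * (1 - κ i) * T i * (x / r - 1 / r ^ 2) := by
          rw [show n ^ 2 * κ i * Tp ^ 2 = κ i * r ^ 2 by rw [hr]; ring]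
          field_simp
          ring
        linarith
      linarith
    have hmono : 1 + n * Tp * x ≤ 1 + n * Tp * X := by gcongr
    refine ⟨⟨hεx, hxX⟩, fun i ↦ ?_, fun i ↦ ?_⟩
    · have hyi := hy i
      have h1 : d i * (1 - κ i) / y i ≤ ∑ i, d i * (1 - κ i) / y i :=
        Finset.single_le_sum (f := fun i ↦ d i * (1 - κ i) / y i) (fun j _ ↦ hterm j)
          (Finset.mem_univ i)
      have h2 : d i * (1 - κ i) / y i * ε ^ 2 ≤ (∑ i, d i * (1 - κ i) / y i) * x ^ 2 :=
        mul_le_mul h1 (by gcongr) (by positivity) ((hterm i).trans h1)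
      have h3 := mul_le_mul_of_nonneg_left hmono hk0
      have h4 : d i * (1 - κ i) * ε ^ 2 / y i ≤ k * (1 + n * Tp * X) + 1 := by
        rw [mul_div_right_comm]
        linarith
      simp only [hδ]
      rw [div_le_iff₀ (by positivity)]
      rw [div_le_iff₀ hyi] at h4
      linarith
    · have := hd i
      have := hT i
      simp only [hY]
      rw [le_div_iff₀ (by positivity)]
      linarith [hyle i]
  set K : Set (ℝ × (ι → ℝ)) := (Set.Icc ε X ×ˢ Set.Icc δ Y) ∩ {p | H p.1 p.2 = 1} with hK
  have hKpos {p : ℝ × (ι → ℝ)} (hp : p ∈ K) : 0 < p.1 ∧ ∀ i, 0 < p.2 i :=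
    ⟨hεpos.trans_le hp.1.1.1, fun i ↦ (hδpos i).trans_le (hp.1.2.1 i)⟩
  have hKc : IsCompact K := by
    refine (isCompact_Icc.prod isCompact_Icc).inter_right ?_
    simp only [hH]
    exact isClosed_eq (by fun_prop) continuous_const
  have hcont : ContinuousOn (fun p : ℝ × (ι → ℝ) ↦ G p.1 p.2) K := by
    simp only [hG]
    have hdiv (i : ι) : ContinuousOn (fun p : ℝ × (ι → ℝ) ↦ d i * (1 - κ i) / p.2 i) K :=
      ContinuousOn.div (by fun_prop) (by fun_prop) fun p hp ↦ ((hKpos hp).2 i).ne'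
    have hsum := continuousOn_finsetSum Finset.univ fun i _ ↦ hdiv i
    fun_prop
  have hmem : (x₁, y₁) ∈ K := by
    obtain ⟨ha, hb⟩ := hbound x₁ y₁ hx₁ hy₁ h₁ le_rfl
    exact ⟨⟨ha, hb⟩, h₁⟩
  obtain ⟨p, hp, hmax⟩ := hKc.exists_isMaxOn ⟨_, hmem⟩ hcont
  refine ⟨p.1, p.2, ⟨(hKpos hp).1, (hKpos hp).2, hp.2⟩, fun x' y' hx' hy' h' ↦ ?_⟩
  rcases le_total c (G x' y') with hc | hc
  · obtain ⟨ha, hb⟩ := hbound x' y' hx' hy' h' hc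
    exact hmax (a := (x', y')) ⟨⟨ha, hb⟩, h'⟩
  · exact hc.trans (hmax hmem)


/-- Theorem 5.2: under conditions (Z) and (I), the scalar curvature functional restricted to
`M¹ = {tr_g T = 1}` attains its global maximum. -/
theorem stmt_7 (m : ℕ) (hm : 1 ≤ m) (d : Fin m → ℕ) (hd : ∀ i, 0 < d i)
    (κ : Fin m → ℝ) (hκ0 : ∀ i, 0 ≤ κ i) (hκ1 : ∀ i, κ i < 1)
    (n : ℝ) (hn : n = 2 * ∑ i, (d i : ℝ) * (1 - κ i))
    (Tp : ℝ) (hTp : 0 < Tp) (T : Fin m → ℝ) (hT : ∀ i, 0 < T i)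
    (S F : ℝ × (Fin m → ℝ) → ℝ)
    (hS : ∀ p, S p = -(1/4) * (∑ i, (d i : ℝ) * (1 - κ i) * p.2 i) / p.1^2
        - n / (2 * p.1) + (1/4) * ∑ i, (d i : ℝ) * κ i / p.2 i)
    (hF : ∀ p, F p = -n * Tp / p.1 + ∑ i, (d i : ℝ) * T i / p.2 i)
    (M1 : Set (ℝ × (Fin m → ℝ)))
    (hM1 : M1 = {p | 0 < p.1 ∧ (∀ i, 0 < p.2 i) ∧ F p = 1})
    (hZ : ∑ i, (n^2 * κ i * Tp^2 - (d i : ℝ)^2 * (1 - κ i) * (T i)^2) / (n * Tp * T i)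
        - 2 * n < 0)
    (m₀ : Fin m) (hm₀ : ∀ i, κ i / T i ≤ κ m₀ / T m₀)
    (hI : (κ m₀ / T m₀) * (-(n * Tp) + ∑ i, (d i : ℝ) * T i)
        < (∑ i, (d i : ℝ)) + (d m₀ : ℝ) * (1 - κ m₀) - 3 * n) :
    ∃ p ∈ M1, ∀ q ∈ M1, S q ≤ S p := by
  have hd' (i) : (0 : ℝ) < d i := Nat.cast_pos.2 (hd i)
  have hnpos : 0 < n := by
    rw [hn]
    have : 0 < ∑ i, (d i : ℝ) * (1 - κ i) :=
      Finset.sum_pos (fun i _ ↦ mul_pos (hd' i) (by linarith [hκ1 i])) ⟨m₀, Finset.mem_univ _⟩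
    linarith
  obtain ⟨x₁, y₁, hx₁, hy₁, h₁, hgt⟩ :=
    exists_inv_curvature_gt (fun i ↦ (d i : ℝ)) κ T hd' hT n Tp hn m₀ hI
  obtain ⟨x, y, ⟨hx, hy, hxy⟩, hmax⟩ :=
    exists_inv_curvature_max (fun i ↦ (d i : ℝ)) κ T hd' hκ0 hκ1 hT n Tp (κ m₀ / T m₀) hnpos hTp
      (div_nonneg (hκ0 m₀) (hT m₀).le) hm₀ hZ _ _ (fun _ _ ↦ rfl) (fun _ _ ↦ rfl)
      x₁ y₁ hx₁ hy₁ h₁ hgt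
  subst hM1
  refine ⟨(x⁻¹, fun i ↦ (y i)⁻¹), ⟨inv_pos.2 hx, fun i ↦ inv_pos.2 (hy i), ?_⟩, ?_⟩
  · rw [hF, ← hxy]
    simp only [div_inv_eq_mul]
  · rintro q ⟨hq₁, hq₂, hq⟩
    have h := hmax q.1⁻¹ (fun i ↦ (q.2 i)⁻¹) (inv_pos.2 hq₁) (fun i ↦ inv_pos.2 (hq₂ i))
      (by rw [← hq, hF]; simp only [div_eq_mul_inv])
    rw [hS, hS]
    convert h using 1
    · simp only [div_eq_mul_inv, inv_inv, inv_pow, mul_inv]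
      ring
    · simp only [div_eq_mul_inv, inv_inv, inv_pow, mul_inv]
      ring
end
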